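/- arXiv:1405.3422 — 4 statements merged into one kernel-verified Lean document; each statement's English description precedes it below -/
import Mathlib

section
/- Let k ≥ 7 be a natural number and let G be a finite simple graph with maximum degree at most k. Suppose uv is an edge of G such that d(u) + d(v) ≤ k + 1 and 2·d(u) ≤ k. Let L be a list assignment on the vertices and edges of G with |L(x)| ≥ k + 1 for every vertex and every edge x. If the graph G − uv (obtained from G by deleting the edge uv) admits a proper L-total-coloring, then G admits a proper L-total-coloring. -/
/-- A proper `L`-total-coloring of `G`: every vertex gets a color from its list,
every edge of `G` gets a color from its list, adjacent vertices receive distinct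
colors, distinct edges sharing an endpoint receive distinct colors, and every edge
receives a color distinct from the colors of both of its endpoints. -/
def IsProperTotalColoring {V : Type*} (G : SimpleGraph V)
    (Lv : V → Finset ℕ) (Le : Sym2 V → Finset ℕ)
    (cv : V → ℕ) (ce : Sym2 V → ℕ) : Prop :=
  (∀ v, cv v ∈ Lv v) ∧
  (∀ e ∈ G.edgeSet, ce e ∈ Le e) ∧
  (∀ x y, G.Adj x y → cv x ≠ cv y) ∧
  (∀ e ∈ G.edgeSet, ∀ f ∈ G.edgeSet, e ≠ f → (∃ x, x ∈ e ∧ x ∈ f) → ce e ≠ ce f) ∧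
  (∀ e ∈ G.edgeSet, ∀ x ∈ e, ce e ≠ cv x)

theorem stmt_1 {V : Type*} [Fintype V] [DecidableEq V]
    (G : SimpleGraph V) [DecidableRel G.Adj]
    (k : ℕ) (hk : 7 ≤ k) (hΔ : ∀ w, G.degree w ≤ k)
    (u v : V) (huv : G.Adj u v)
    (hdeg : G.degree u + G.degree v ≤ k + 1)
    (hdeg2 : 2 * G.degree u ≤ k)
    (Lv : V → Finset ℕ) (Le : Sym2 V → Finset ℕ)
    (hLv : ∀ w, k + 1 ≤ (Lv w).card)
    (hLe : ∀ e ∈ G.edgeSet, k + 1 ≤ (Le e).card)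
    (h : ∃ cv ce, IsProperTotalColoring (G.deleteEdges {s(u, v)}) Lv Le cv ce) :
    ∃ cv ce, IsProperTotalColoring G Lv Le cv ce := by
  obtain ⟨cv, ce, h1, h2, h3, h4, h5⟩ := h
  have hE : s(u, v) ∈ G.edgeSet := huv
  have hmem : ∀ e, e ∈ G.edgeSet → e ≠ s(u, v) → e ∈ (G.deleteEdges {s(u, v)}).edgeSet := by
    intro e he hne
    rw [SimpleGraph.edgeSet_deleteEdges]
    exact ⟨he, hne⟩
  obtain ⟨c, hcL, hc⟩ : ∃ c ∈ Le s(u, v),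
      c ∉ (((G.incidenceFinset u).erase s(u, v)).image ce ∪
        ((G.incidenceFinset v).erase s(u, v)).image ce) ∪ {cv v} := by
    apply Finset.exists_mem_notMem_of_card_lt_card
    have a1 := Finset.card_union_le (((G.incidenceFinset u).erase s(u, v)).image ce ∪
        ((G.incidenceFinset v).erase s(u, v)).image ce) {cv v}
    have a2 := Finset.card_union_le (((G.incidenceFinset u).erase s(u, v)).image ce)
        (((G.incidenceFinset v).erase s(u, v)).image ce)
    have a3 := Finset.card_image_le (s := (G.incidenceFinset u).erase s(u, v)) (f := ce)
    have a4 := Finset.card_image_le (s := (G.incidenceFinset v).erase s(u, v)) (f := ce)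
    have m1 : s(u, v) ∈ G.incidenceFinset u := by
      rw [SimpleGraph.mem_incidenceFinset]; exact ⟨hE, by simp⟩
    have m2 : s(u, v) ∈ G.incidenceFinset v := by
      rw [SimpleGraph.mem_incidenceFinset]; exact ⟨hE, by simp⟩
    have p1 := Finset.card_pos.2 ⟨_, m1⟩
    have p2 := Finset.card_pos.2 ⟨_, m2⟩
    rw [Finset.card_erase_of_mem m1] at a3
    rw [Finset.card_erase_of_mem m2] at a4
    rw [SimpleGraph.card_incidenceFinset_eq_degree] at a3 a4 p1 p2
    rw [Finset.card_singleton] at a1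
    have := hLe _ hE
    omega
  have hcv : c ≠ cv v := by
    rintro rfl; simp at hc
  have hce : ∀ e ∈ G.edgeSet, e ≠ s(u, v) → (u ∈ e ∨ v ∈ e) → ce e ≠ c := by
    rintro e he hne hx rfl
    apply hc
    simp only [Finset.mem_union, Finset.mem_image, Finset.mem_erase,
      SimpleGraph.mem_incidenceFinset]
    left
    rcases hx with hx | hx
    · exact Or.inl ⟨e, ⟨hne, he, hx⟩, rfl⟩
    · exact Or.inr ⟨e, ⟨hne, he, hx⟩, rfl⟩
  obtain ⟨ce', hce'⟩ : ∃ f, f = Function.update ce s(u, v) c := ⟨_, rfl⟩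
  have hs : ce' s(u, v) = c := by simp [hce']
  have hn : ∀ e, e ≠ s(u, v) → ce' e = ce e := by
    intro e he; simp [hce', he]
  obtain ⟨b, hbL, hb⟩ : ∃ b ∈ Lv u,
      b ∉ (G.neighborFinset u).image cv ∪ (G.incidenceFinset u).image ce' := by
    apply Finset.exists_mem_notMem_of_card_lt_card
    have a1 := Finset.card_union_le ((G.neighborFinset u).image cv)
      ((G.incidenceFinset u).image ce')
    have a2 := Finset.card_image_le (s := G.neighborFinset u) (f := cv)
    have a3 := Finset.card_image_le (s := G.incidenceFinset u) (f := ce')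
    rw [SimpleGraph.card_incidenceFinset_eq_degree] at a3
    rw [SimpleGraph.card_neighborFinset_eq_degree] at a2
    have := hLv u
    omega
  have hb1 : ∀ w, G.Adj u w → cv w ≠ b := by
    rintro w hw rfl
    apply hb
    simp only [Finset.mem_union, Finset.mem_image, SimpleGraph.mem_neighborFinset]
    exact Or.inl ⟨w, hw, rfl⟩
  have hb2 : ∀ e ∈ G.edgeSet, u ∈ e → ce' e ≠ b := by
    rintro e he hu rfl
    apply hb
    simp only [Finset.mem_union, Finset.mem_image, SimpleGraph.mem_incidenceFinset]
    exact Or.inr ⟨e, ⟨he, hu⟩, rfl⟩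
  have hmm : ∀ x, x ∈ s(u, v) → x = u ∨ x = v := fun x hx => Sym2.mem_iff.1 hx
  refine ⟨Function.update cv u b, ce', ?_, ?_, ?_, ?_, ?_⟩
  · intro w
    by_cases hw : w = u
    · subst hw; simpa using hbL
    · simpa [hw] using h1 w
  · intro e he
    by_cases hne : e = s(u, v)
    · rw [hne, hs]; exact hcL
    · rw [hn e hne]; exact h2 e (hmem e he hne)
  · intro x y hxy
    by_cases hx : x = u
    · subst hx
      have hy : y ≠ x := hxy.ne'
      simpa [hy] using (hb1 y hxy).symm
    · by_cases hy : y = u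
      · subst hy
        simpa [hx] using hb1 x hxy.symm
      · simp only [Function.update_of_ne hx, Function.update_of_ne hy]
        apply h3
        have : s(x, y) ∈ (G.deleteEdges {s(u, v)}).edgeSet := by
          apply hmem _ hxy
          intro heq
          have hu : u ∈ s(x, y) := by rw [heq]; simp
          rcases Sym2.mem_iff.1 hu with h | h
          · exact hx h.symm
          · exact hy h.symm
        exact this
  · intro e he f hf hef hx
    obtain ⟨x, hxe, hxf⟩ := hx
    by_cases h1e : e = s(u, v)
    · have h1f : f ≠ s(u, v) := fun h => hef (h1e.trans h.symm)
      rw [hn f h1f, h1e, hs]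
      rw [h1e] at hxe
      refine (hce f hf h1f ?_).symm
      rcases hmm x hxe with rfl | rfl
      · exact Or.inl hxf
      · exact Or.inr hxf
    · by_cases h1f : f = s(u, v)
      · rw [hn e h1e, h1f, hs]
        rw [h1f] at hxf
        refine hce e he h1e ?_
        rcases hmm x hxf with rfl | rfl
        · exact Or.inl hxe
        · exact Or.inr hxe
      · rw [hn e h1e, hn f h1f]
        exact h4 e (hmem e he h1e) f (hmem f hf h1f) hef ⟨x, hxe, hxf⟩
  · intro e he x hx
    by_cases hxu : x = u
    · subst hxu
      simpa using hb2 e he hx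
    · rw [Function.update_of_ne hxu]
      by_cases h1e : e = s(u, v)
      · rw [h1e] at hx
        rcases hmm x hx with h | h
        · exact absurd h hxu
        · rw [h1e, hs, h]; exact hcv
      · rw [hn e h1e]
        exact h5 e (hmem e he h1e) x hx
end

section
/- Let k ≥ 7 be a natural number and let G be a finite simple graph with maximum degree at most k. Suppose u is a vertex of G with d(u) = 4 that has two distinct neighbors u_1 and u_2 with d(u_1) = d(u_2) = 4. Let L be a list assignment on the vertices and edges of G with |L(x)| ≥ k + 1 for every vertex and every edge x. If the graph obtained from G by deleting the two edges uu_1 and uu_2 admits a proper L-total-coloring, then G admits a proper L-total-coloring. -/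
theorem exists_avoid (S T : Finset ℕ) (h : T.card < S.card) : ∃ a ∈ S, a ∉ T :=
  Finset.exists_mem_notMem_of_card_lt_card h

theorem fan_choose (A B1 B2 C1 C2 : Finset ℕ) (hA : 4 ≤ A.card) (hB1 : 3 ≤ B1.card)
    (hB2 : 3 ≤ B2.card) (hC1 : 2 ≤ C1.card) (hC2 : 2 ≤ C2.card) :
    ∃ a ∈ A, ∃ b1 ∈ B1, ∃ b2 ∈ B2, ∃ c1 ∈ C1, ∃ c2 ∈ C2,
      a ≠ b1 ∧ a ≠ b2 ∧ a ≠ c1 ∧ a ≠ c2 ∧ b1 ≠ b2 ∧ b1 ≠ c1 ∧ b2 ≠ c2 := by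
  obtain ⟨C, hC, hCc⟩ := Finset.exists_subset_card_eq hC1
  obtain ⟨b1, hb1, hb1C⟩ := exists_avoid B1 C (by omega)
  obtain ⟨c2, hc2, -⟩ := exists_avoid C2 ∅ (by rw [Finset.card_empty]; omega)
  obtain ⟨b2, hb2, hb2'⟩ := exists_avoid B2 {b1, c2} (by
    have := Finset.card_le_two (a := b1) (b := c2); omega)
  obtain ⟨a, ha, ha'⟩ := exists_avoid A {b1, b2, c2} (by
    have := Finset.card_le_three (a := b1) (b := b2) (c := c2); omega)
  obtain ⟨c1, hc1, hc1'⟩ := exists_avoid C {a} (by simp; omega)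
  refine ⟨a, ha, b1, hb1, b2, hb2, c1, hC hc1, c2, hc2, ?_⟩
  simp at hb2' ha' hc1'
  have : b1 ≠ c1 := by rintro rfl; exact hb1C hc1
  grind

theorem wheel_aux (A B1 B2 C1 C2 : Finset ℕ) (hA : 4 ≤ A.card)
    (hB2 : 3 ≤ B2.card) (hC1 : 3 ≤ C1.card) (hC2 : 3 ≤ C2.card)
    (A' : Finset ℕ) (hA' : A' ⊆ A) (hAc : A'.card = 4) (b1 : ℕ) (hb1 : b1 ∈ B1) (hb1A : b1 ∉ A') :
    ∃ a ∈ A, ∃ b1 ∈ B1, ∃ b2 ∈ B2, ∃ c1 ∈ C1, ∃ c2 ∈ C2,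
      a ≠ b1 ∧ a ≠ b2 ∧ a ≠ c1 ∧ a ≠ c2 ∧ b1 ≠ b2 ∧ b1 ≠ c1 ∧ b2 ≠ c2 ∧ c1 ≠ c2 := by
  obtain ⟨c1, hc1, hc1'⟩ := exists_avoid C1 {b1} (by simp; omega)
  obtain ⟨c2, hc2, hc2'⟩ := exists_avoid C2 {c1} (by simp; omega)
  obtain ⟨b2, hb2, hb2'⟩ := exists_avoid B2 {b1, c2} (by
    have := Finset.card_le_two (a := b1) (b := c2); omega)
  obtain ⟨a, ha, ha'⟩ := exists_avoid A' {c1, b2, c2} (by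
    have := Finset.card_le_three (a := c1) (b := b2) (c := c2); omega)
  refine ⟨a, hA' ha, b1, hb1, b2, hb2, c1, hc1, c2, hc2, ?_⟩
  simp at hb2' ha' hc1' hc2'
  have : a ≠ b1 := by rintro rfl; exact hb1A ha
  grind

theorem wheel_choose (A B1 B2 C1 C2 : Finset ℕ) (hA : 4 ≤ A.card) (hB1 : 3 ≤ B1.card)
    (hB2 : 3 ≤ B2.card) (hC1 : 3 ≤ C1.card) (hC2 : 3 ≤ C2.card) :
    ∃ a ∈ A, ∃ b1 ∈ B1, ∃ b2 ∈ B2, ∃ c1 ∈ C1, ∃ c2 ∈ C2,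
      a ≠ b1 ∧ a ≠ b2 ∧ a ≠ c1 ∧ a ≠ c2 ∧ b1 ≠ b2 ∧ b1 ≠ c1 ∧ b2 ≠ c2 ∧ c1 ≠ c2 := by
  by_cases hd : Disjoint B1 C2
  · obtain ⟨A', hA', hAc⟩ := Finset.exists_subset_card_eq hA
    obtain ⟨x, hx, hxA⟩ := exists_avoid (B1 ∪ C2) A' (by
      rw [Finset.card_union_of_disjoint hd]; omega)
    rcases Finset.mem_union.1 hx with hx | hx
    · exact wheel_aux A B1 B2 C1 C2 hA hB2 hC1 hC2 A' hA' hAc x hx hxA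
    · obtain ⟨a, ha, c2, hc2, c1, hc1, b2, hb2, b1, hb1, h⟩ :=
        wheel_aux A C2 C1 B2 B1 hA hC1 hB2 hB1 A' hA' hAc x hx hxA
      exact ⟨a, ha, b1, hb1, b2, hb2, c1, hc1, c2, hc2, by grind⟩
  · obtain ⟨x, hx1, hx2⟩ := Finset.not_disjoint_iff.1 hd
    obtain ⟨b2, hb2, hb2'⟩ := exists_avoid B2 {x} (by simp; omega)
    obtain ⟨c1, hc1, hc1'⟩ := exists_avoid C1 {x} (by simp; omega)
    obtain ⟨a, ha, ha'⟩ := exists_avoid A {x, b2, c1} (by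
      have := Finset.card_le_three (a := x) (b := b2) (c := c1); omega)
    simp at hb2' ha' hc1'
    exact ⟨a, ha, x, hx1, b2, hb2, c1, hc1, x, hx2, by grind⟩

theorem both_choose (P : Prop) (A B1 B2 C1 C2 : Finset ℕ) (hA : 4 ≤ A.card) (hB1 : 3 ≤ B1.card)
    (hB2 : 3 ≤ B2.card) (hC1 : 2 ≤ C1.card) (hC2 : 2 ≤ C2.card)
    (hP1 : P → 3 ≤ C1.card) (hP2 : P → 3 ≤ C2.card) :
    ∃ a ∈ A, ∃ b1 ∈ B1, ∃ b2 ∈ B2, ∃ c1 ∈ C1, ∃ c2 ∈ C2,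
      a ≠ b1 ∧ a ≠ b2 ∧ a ≠ c1 ∧ a ≠ c2 ∧ b1 ≠ b2 ∧ b1 ≠ c1 ∧ b2 ≠ c2 ∧ (P → c1 ≠ c2) := by
  by_cases h : P
  · simpa [h] using wheel_choose A B1 B2 C1 C2 hA hB1 hB2 (hP1 h) (hP2 h)
  · simpa [h] using fan_choose A B1 B2 C1 C2 hA hB1 hB2 hC1 hC2

theorem avail_card (L S : Finset ℕ) (n m k : ℕ) (hL : k + 1 ≤ L.card) (hS : S.card ≤ n)
    (hk : n + m ≤ k + 1) : m ≤ (L \ S).card := by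
  have := Finset.le_card_sdiff S L
  omega

theorem two_images {V : Type*} (S T : Finset V) (f g : V → ℕ) :
    (S.image f ∪ T.image g).card ≤ S.card + T.card :=
  (Finset.card_union_le _ _).trans (add_le_add Finset.card_image_le Finset.card_image_le)

theorem stmt_8 {V : Type*} [Fintype V] [DecidableEq V]
    (G : SimpleGraph V) [DecidableRel G.Adj]
    (k : ℕ) (hk : 7 ≤ k) (hΔ : ∀ w, G.degree w ≤ k)
    (u u₁ u₂ : V) (h12 : u₁ ≠ u₂)
    (ha1 : G.Adj u u₁) (ha2 : G.Adj u u₂)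
    (hdu : G.degree u = 4) (hd1 : G.degree u₁ = 4) (hd2 : G.degree u₂ = 4)
    (Lv : V → Finset ℕ) (Le : Sym2 V → Finset ℕ)
    (hLv : ∀ w, k + 1 ≤ (Lv w).card)
    (hLe : ∀ e ∈ G.edgeSet, k + 1 ≤ (Le e).card)
    (h : ∃ cv ce,
      IsProperTotalColoring (G.deleteEdges {s(u, u₁), s(u, u₂)}) Lv Le cv ce) :
    ∃ cv ce, IsProperTotalColoring G Lv Le cv ce := by
  obtain ⟨cv, ce, h1, h2, h3, h4, h5⟩ := h
  have hu1 : u ≠ u₁ := ha1.ne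
  have hu2 : u ≠ u₂ := ha2.ne
  set N := (G.neighborFinset u).erase u₁ |>.erase u₂ with hN
  set N1 := (G.neighborFinset u₁).erase u with hN1
  set N2 := (G.neighborFinset u₂).erase u with hN2
  have cN : N.card = 2 := by
    rw [hN, Finset.card_erase_of_mem (by simp [ha2, h12.symm]),
      Finset.card_erase_of_mem (by simp [ha1]), G.card_neighborFinset_eq_degree, hdu]
  have cN1 : N1.card = 3 := by
    rw [hN1, Finset.card_erase_of_mem (by simp [ha1.symm]), G.card_neighborFinset_eq_degree, hd1]
  have cN2 : N2.card = 3 := by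
    rw [hN2, Finset.card_erase_of_mem (by simp [ha2.symm]), G.card_neighborFinset_eq_degree, hd2]
  have cM1 : (N1.erase u₂).card ≤ 3 := (Finset.card_erase_le).trans cN1.le
  have cM2 : (N2.erase u₁).card ≤ 3 := (Finset.card_erase_le).trans cN2.le
  have cM1' : G.Adj u₁ u₂ → (N1.erase u₂).card ≤ 2 := fun h => by
    rw [Finset.card_erase_of_mem (by simp [hN1, h, hu2.symm]), cN1]
  have cM2' : G.Adj u₁ u₂ → (N2.erase u₁).card ≤ 2 := fun h => by
    rw [Finset.card_erase_of_mem (by simp [hN2, h.symm, hu1.symm]), cN2]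
  have iA := two_images N N cv (fun w => ce s(u, w))
  have iB1 := two_images N N1 (fun w => ce s(u, w)) (fun w => ce s(u₁, w))
  have iB2 := two_images N N2 (fun w => ce s(u, w)) (fun w => ce s(u₂, w))
  have iC1 := two_images (N1.erase u₂) N1 cv (fun w => ce s(u₁, w))
  have iC2 := two_images (N2.erase u₁) N2 cv (fun w => ce s(u₂, w))
  obtain ⟨a, ha, b1, hb1, b2, hb2, c1, hc1, c2, hc2, n1, n2, n3, n4, n5, n6, n7, n8⟩ :=
    both_choose (G.Adj u₁ u₂) _ _ _ _ _
      (avail_card _ _ 4 4 k (hLv u) (iA.trans (by omega)) (by omega))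
      (avail_card _ _ 5 3 k (hLe s(u, u₁) ha1) (iB1.trans (by omega)) (by omega))
      (avail_card _ _ 5 3 k (hLe s(u, u₂) ha2) (iB2.trans (by omega)) (by omega))
      (avail_card _ _ 6 2 k (hLv u₁) (iC1.trans (by omega)) (by omega))
      (avail_card _ _ 6 2 k (hLv u₂) (iC2.trans (by omega)) (by omega))
      (fun h => avail_card _ _ 5 3 k (hLv u₁) (iC1.trans (by have := cM1' h; omega)) (by omega))
      (fun h => avail_card _ _ 5 3 k (hLv u₂) (iC2.trans (by have := cM2' h; omega)) (by omega))
  simp only [Finset.mem_sdiff, Finset.mem_union, Finset.mem_image, not_or, not_exists, not_and,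
    hN, hN1, hN2, Finset.mem_erase, SimpleGraph.mem_neighborFinset, and_imp] at ha hb1 hb2 hc1 hc2
  obtain ⟨la, a1, a2⟩ := ha
  obtain ⟨lb1, b11, b12⟩ := hb1
  obtain ⟨lb2, b21, b22⟩ := hb2
  obtain ⟨lc1, c11, c12⟩ := hc1
  obtain ⟨lc2, c21, c22⟩ := hc2
  clear iA iB1 iB2 iC1 iC2 cM1 cM2 cM1' cM2' cN cN1 cN2 hd1 hd2 hdu hΔ hLv hLe
  clear_value N N1 N2
  clear hN hN1 hN2
  -- reformulate the old coloring
  have sN : ∀ x y, s(x, y) ≠ s(u, u₁) → s(x, y) ≠ s(u, u₂) → G.Adj x y →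
      s(x, y) ∈ (G.deleteEdges {s(u, u₁), s(u, u₂)}).edgeSet := by
    intro x y e1 e2 h
    simp only [SimpleGraph.mem_edgeSet, SimpleGraph.deleteEdges_adj, Set.mem_insert_iff,
      Set.mem_singleton_iff]
    tauto
  have o3 : ∀ x y, s(x, y) ≠ s(u, u₁) → s(x, y) ≠ s(u, u₂) → G.Adj x y → cv x ≠ cv y :=
    fun x y e1 e2 h => h3 x y (sN x y e1 e2 h)
  have o2 : ∀ x y, s(x, y) ≠ s(u, u₁) → s(x, y) ≠ s(u, u₂) → G.Adj x y →
      ce s(x, y) ∈ Le s(x, y) := fun x y e1 e2 h => h2 _ (sN x y e1 e2 h)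
  have o5 : ∀ x y, s(x, y) ≠ s(u, u₁) → s(x, y) ≠ s(u, u₂) → G.Adj x y →
      ce s(x, y) ≠ cv x := fun x y e1 e2 h => h5 _ (sN x y e1 e2 h) x (by simp)
  have o4 : ∀ x y z, s(x, y) ≠ s(u, u₁) → s(x, y) ≠ s(u, u₂) → G.Adj x y →
      s(x, z) ≠ s(u, u₁) → s(x, z) ≠ s(u, u₂) → G.Adj x z → y ≠ z →
      ce s(x, y) ≠ ce s(x, z) := fun x y z e1 e2 h e3 e4 h' hyz =>
    h4 _ (sN x y e1 e2 h) _ (sN x z e3 e4 h') (by rw [Ne, Sym2.eq_iff]; grind) ⟨x, by simp, by simp⟩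
  clear h2 h3 h4 h5 sN
  obtain ⟨cv', hcv'⟩ : ∃ cv' : V → ℕ, cv' = fun x => if x = u then a else if x = u₁ then c1
    else if x = u₂ then c2 else cv x := ⟨_, rfl⟩
  obtain ⟨ce', hce'⟩ : ∃ ce' : Sym2 V → ℕ, ce' = fun e => if e = s(u, u₁) then b1 else
    if e = s(u, u₂) then b2 else ce e := ⟨_, rfl⟩
  have vu : cv' u = a := by simp [hcv']
  have v1 : cv' u₁ = c1 := by simp [hcv', hu1.symm]
  have v2 : cv' u₂ = c2 := by simp [hcv', hu2.symm, h12.symm]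
  have v0 : ∀ x, x ≠ u → x ≠ u₁ → x ≠ u₂ → cv' x = cv x := by
    intro x p q r; simp [hcv', p, q, r]
  have e1 : ce' s(u, u₁) = b1 := by simp [hce']
  have e2 : ce' s(u, u₂) = b2 := by simp [hce', h12.symm, hu1]
  have e0 : ∀ x y, s(x, y) ≠ s(u, u₁) → s(x, y) ≠ s(u, u₂) → ce' s(x, y) = ce s(x, y) := by
    intro x y p q; simp only [hce', if_neg p, if_neg q]
  clear hcv' hce'
  have sw : ∀ x y : V, s(x, y) = s(y, x) := fun x y => Sym2.eq_swap
  have si : ∀ x y z w : V, s(x, y) = s(z, w) ↔ (x = z ∧ y = w) ∨ (x = w ∧ y = z) :=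
    fun x y z w => by simp
  have cl : ∀ x y, G.Adj x y → s(x, y) = s(u, u₁) ∨ s(x, y) = s(u, u₂) ∨
    (s(x, y) ≠ s(u, u₁) ∧ s(x, y) ≠ s(u, u₂)) := fun x y _ => by tauto
  have ac := G.adj_comm
  -- edges avoiding the new ones
  have eu : ∀ y, y ≠ u₁ → y ≠ u₂ → s(u, y) ≠ s(u, u₁) ∧ s(u, y) ≠ s(u, u₂) := by
    intro y p q; simp [si, p, q, hu1, hu2]
  have eo : ∀ x y, x ≠ u → y ≠ u → s(x, y) ≠ s(u, u₁) ∧ s(x, y) ≠ s(u, u₂) := by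
    intro x y p q; simp [si, p, q]
  have eo' : ∀ x y, x ≠ u → x ≠ u₁ → x ≠ u₂ → s(x, y) ≠ s(u, u₁) ∧ s(x, y) ≠ s(u, u₂) := by
    intro x y p q r; simp [si, p, q, r]
  have H3 : ∀ x y, G.Adj x y → cv' x ≠ cv' y := by
    have key : ∀ y, G.Adj u y → a ≠ cv' y := by
      intro y hy
      by_cases p : y = u₁
      · rw [p, v1]; exact n3
      by_cases q : y = u₂
      · rw [q, v2]; exact n4
      rw [v0 y hy.ne' p q]; exact Ne.symm (a1 y q p hy)
    have key1 : ∀ y, G.Adj u₁ y → c1 ≠ cv' y := by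
      intro y hy
      by_cases p : y = u
      · rw [p, vu]; exact n3.symm
      by_cases q : y = u₂
      · rw [q, v2]; exact n8 (q ▸ hy)
      rw [v0 y p hy.ne' q]; exact Ne.symm (c11 y q p hy)
    have key2 : ∀ y, G.Adj u₂ y → c2 ≠ cv' y := by
      intro y hy
      by_cases p : y = u
      · rw [p, vu]; exact n4.symm
      by_cases q : y = u₁
      · rw [q, v1]; exact (n8 (q ▸ hy.symm)).symm
      rw [v0 y p q hy.ne']; exact Ne.symm (c21 y q p hy)
    intro x y hxy
    by_cases p : x = u
    · subst p; rw [vu]; exact key y hxy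
    by_cases q : x = u₁
    · subst q; rw [v1]; exact key1 y hxy
    by_cases r : x = u₂
    · subst r; rw [v2]; exact key2 y hxy
    by_cases p' : y = u
    · subst p'; rw [vu]; exact (key x hxy.symm).symm
    by_cases q' : y = u₁
    · subst q'; rw [v1]; exact (key1 x hxy.symm).symm
    by_cases r' : y = u₂
    · subst r'; rw [v2]; exact (key2 x hxy.symm).symm
    rw [v0 x p q r, v0 y p' q' r']
    exact o3 x y (eo' x y p q r).1 (eo' x y p q r).2 hxy
  have H5 : ∀ x y, G.Adj x y → ce' s(x, y) ≠ cv' x := by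
    intro x y hxy
    by_cases p : x = u
    · subst p
      by_cases q : y = u₁
      · grind
      by_cases r : y = u₂
      · grind
      rw [e0 _ _ (eu y q r).1 (eu y q r).2, vu]
      exact a2 y r q hxy
    by_cases q : x = u₁
    · subst q
      by_cases r : y = u
      · rw [r, sw, e1, v1]; exact n6
      rw [e0 _ _ (eo _ y p r).1 (eo _ y p r).2, v1]
      exact c12 y r hxy
    by_cases q' : x = u₂
    · subst q'
      by_cases r : y = u
      · rw [r, sw, e2, v2]; exact n7
      rw [e0 _ _ (eo _ y p r).1 (eo _ y p r).2, v2]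
      exact c22 y r hxy
    rw [e0 _ _ (eo' x y p q q').1 (eo' x y p q q').2, v0 x p q q']
    exact o5 x y (eo' x y p q q').1 (eo' x y p q q').2 hxy
  have H4 : ∀ x y z, G.Adj x y → G.Adj x z → y ≠ z → ce' s(x, y) ≠ ce' s(x, z) := by
    intro x y z hxy hxz hyz
    by_cases p : x = u
    · subst p
      have k1 : ∀ w, G.Adj x w → w ≠ u₁ → b1 ≠ ce' s(x, w) := by
        intro w hw p
        by_cases q : w = u₂
        · rw [q, e2]; exact n5
        rw [e0 _ _ (eu w p q).1 (eu w p q).2]; exact Ne.symm (b11 w q p hw)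
      have k2 : ∀ w, G.Adj x w → w ≠ u₂ → b2 ≠ ce' s(x, w) := by
        intro w hw p
        by_cases q : w = u₁
        · rw [q, e1]; exact n5.symm
        rw [e0 _ _ (eu w q p).1 (eu w q p).2]; exact Ne.symm (b21 w p q hw)
      by_cases q : y = u₁
      · rw [q, e1]; exact k1 z hxz (q ▸ hyz.symm)
      by_cases r : y = u₂
      · rw [r, e2]; exact k2 z hxz (r ▸ hyz.symm)
      by_cases q' : z = u₁
      · rw [q', e1]; exact (k1 y hxy q).symm
      by_cases r' : z = u₂
      · rw [r', e2]; exact (k2 y hxy r).symm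
      obtain ⟨s1, s2⟩ := eu y q r
      obtain ⟨s3, s4⟩ := eu z q' r'
      rw [e0 _ _ s1 s2, e0 _ _ s3 s4]
      exact o4 x y z s1 s2 hxy s3 s4 hxz hyz
    by_cases hy : y ≠ u ∧ z ≠ u ∨ x ≠ u₁ ∧ x ≠ u₂
    · have : (s(x, y) ≠ s(u, u₁) ∧ s(x, y) ≠ s(u, u₂)) ∧
          (s(x, z) ≠ s(u, u₁) ∧ s(x, z) ≠ s(u, u₂)) := by
        rcases hy with ⟨r, r'⟩ | ⟨r, r'⟩
        · exact ⟨eo x y p r, eo x z p r'⟩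
        · exact ⟨eo' x y p r r', eo' x z p r r'⟩
      obtain ⟨⟨s1, s2⟩, s3, s4⟩ := this
      rw [e0 _ _ s1 s2, e0 _ _ s3 s4]
      exact o4 x y z s1 s2 hxy s3 s4 hxz hyz
    have k1 : ∀ w, G.Adj u₁ w → w ≠ u → b1 ≠ ce' s(u₁, w) := by
      intro w hw p
      have := eo u₁ w hu1.symm p
      rw [e0 _ _ this.1 this.2]; exact Ne.symm (b12 w p hw)
    have k2 : ∀ w, G.Adj u₂ w → w ≠ u → b2 ≠ ce' s(u₂, w) := by
      intro w hw p
      have := eo u₂ w hu2.symm p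
      rw [e0 _ _ this.1 this.2]; exact Ne.symm (b22 w p hw)
    have hx : x = u₁ ∨ x = u₂ := by tauto
    have hyz' : y = u ∨ z = u := by tauto
    rcases hx with rfl | rfl <;> rcases hyz' with rfl | rfl
    · rw [sw x y, e1]; exact k1 z hxz hyz.symm
    · rw [sw x z, e1]; exact (k1 y hxy hyz).symm
    · rw [sw x y, e2]; exact k2 z hxz hyz.symm
    · rw [sw x z, e2]; exact (k2 y hxy hyz).symm
  refine ⟨cv', ce', ?_, ?_, H3, ?_, ?_⟩
  · intro x
    by_cases p : x = u
    · subst p; rwa [vu]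
    by_cases q : x = u₁
    · subst q; rwa [v1]
    by_cases r : x = u₂
    · subst r; rwa [v2]
    rw [v0 x p q r]; exact h1 x
  · intro e
    induction e with | _ x y
    intro hxy
    by_cases p : s(x, y) = s(u, u₁)
    · rw [p, e1]; exact lb1
    by_cases q : s(x, y) = s(u, u₂)
    · rw [q, e2]; exact lb2
    rw [e0 x y p q]; exact o2 x y p q hxy
  · rintro e he f hf hef ⟨x, hxe, hxf⟩
    obtain ⟨y, rfl⟩ := Sym2.mem_iff_exists.1 hxe
    obtain ⟨z, rfl⟩ := Sym2.mem_iff_exists.1 hxf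
    exact H4 x y z he hf (fun h => hef (by rw [h]))
  · intro e he x hxe
    obtain ⟨y, rfl⟩ := Sym2.mem_iff_exists.1 hxe
    exact H5 x y he
end

section
/- Let Γ be the complete bipartite graph K_{2,3}, with parts {y, y'} (the two vertices of degree 3) and {z, w_1, w_2} (the three vertices of degree 2). Let L be a list assignment on the six edges of Γ such that |L(yz)| ≥ 3 and |L(y'z)| ≥ 3 (the two edges incident to z), |L(e)| ≥ 2 for each of the other four edges e ∈ {yw_1, yw_2, y'w_1, y'w_2}, and such that L(yw_1) ≠ L(yw_2) (the lists of the two edges incident to y but not to z are not equal as sets). Then Γ admits a proper L-edge-coloring. -/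
/-- A proper `L`-edge-coloring of `G`: every edge of `G` gets a color from its list,
and any two distinct edges of `G` sharing an endpoint receive distinct colors. -/
def IsProperEdgeColoring {V : Type*} (G : SimpleGraph V)
    (L : Sym2 V → Finset ℕ) (c : Sym2 V → ℕ) : Prop :=
  (∀ e ∈ G.edgeSet, c e ∈ L e) ∧
  ∀ e ∈ G.edgeSet, ∀ f ∈ G.edgeSet, e ≠ f → (∃ x, x ∈ e ∧ x ∈ f) → c e ≠ c f

theorem pair_sub (B1 B2 : Finset ℕ) (h1 : 2 ≤ B1.card) (h2 : 2 ≤ B2.card) (h : B1 ≠ B2) :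
    ∃ p ∈ B1, ∃ q ∈ B1, ∃ r ∈ B2, ∃ s ∈ B2, p ≠ q ∧ r ≠ s ∧ p ≠ r ∧ p ≠ s ∧ q ≠ r := by
  have key : ∀ B1 B2 : Finset ℕ, 2 ≤ B1.card → 2 ≤ B2.card → (∃ p ∈ B1, p ∉ B2) →
    ∃ p ∈ B1, ∃ q ∈ B1, ∃ r ∈ B2, ∃ s ∈ B2, p ≠ q ∧ r ≠ s ∧ p ≠ r ∧ p ≠ s ∧ q ≠ r := by
    rintro B1 B2 h1 h2 ⟨p, hp, hp2⟩
    obtain ⟨q, hq, hqp⟩ := Finset.exists_mem_ne (by omega : 1 < B1.card) p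
    obtain ⟨r, hr, hrq⟩ := Finset.exists_mem_ne (by omega : 1 < B2.card) q
    obtain ⟨s, hs, hsr⟩ := Finset.exists_mem_ne (by omega : 1 < B2.card) r
    exact ⟨p, hp, q, hq, r, hr, s, hs, by grind⟩
  by_cases hs : B1 ⊆ B2
  · have : ∃ p ∈ B2, p ∉ B1 := by
      by_contra hc
      push Not at hc
      exact h (Finset.Subset.antisymm hs hc)
    obtain ⟨p, hp, q, hq, r, hr, s, hs, h⟩ := key B2 B1 h2 h1 this
    exact ⟨r, hr, s, hs, p, hp, q, hq, by grind⟩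
  · exact key B1 B2 h1 h2 (Finset.not_subset.1 hs)

theorem fin_step (A A' : Finset ℕ) (hA : 3 ≤ A.card) (hA' : 3 ≤ A'.card) (b1 b2 c1 c2 : ℕ)
    (h : ¬ ∃ a ∈ A, ∃ a' ∈ A', a ≠ a' ∧ a ≠ b1 ∧ a ≠ b2 ∧ a' ≠ c1 ∧ a' ≠ c2) :
    ∃ x, x ≠ b1 ∧ x ≠ b2 ∧ x ≠ c1 ∧ x ≠ c2 ∧ A = {b1, b2, x} ∧ A' = {c1, c2, x} := by
  have f : ∀ (A : Finset ℕ) (b1 b2 : ℕ), 3 ≤ A.card → ∃ a ∈ A, a ≠ b1 ∧ a ≠ b2 := by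
    intro A b1 b2 hA
    by_contra hc
    push Not at hc
    have : A ⊆ {b1, b2} := by intro a ha; have := hc a ha; simp; tauto
    have := Finset.card_le_card this
    have := Finset.card_le_two (a := b1) (b := b2)
    omega
  obtain ⟨a, ha, ha1, ha2⟩ := f A b1 b2 hA
  obtain ⟨a', ha', ha1', ha2'⟩ := f A' c1 c2 hA'
  push Not at h
  have e : a = a' := by grind
  subst e
  refine ⟨a, ha1, ha2, ha1', ha2', ?_, ?_⟩
  · apply Finset.eq_of_subset_of_card_le
    · intro y hy; simp; grind
    · exact Finset.card_le_three.trans hA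
  · apply Finset.eq_of_subset_of_card_le
    · intro y hy; simp; grind
    · exact Finset.card_le_three.trans hA'

def Good (A A' B1 B2 C1 C2 : Finset ℕ) : Prop :=
  ∃ b1 ∈ B1, ∃ b2 ∈ B2, ∃ c1 ∈ C1, ∃ c2 ∈ C2, (b1 ≠ b2 ∧ c1 ≠ c2 ∧ b1 ≠ c1 ∧ b2 ≠ c2) ∧
    ∃ a ∈ A, ∃ a' ∈ A', a ≠ a' ∧ a ≠ b1 ∧ a ≠ b2 ∧ a' ≠ c1 ∧ a' ≠ c2

theorem good (A A' B1 B2 C1 C2 : Finset ℕ) (hA : 3 ≤ A.card) (hA' : 3 ≤ A'.card)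
    (hB1 : 2 ≤ B1.card) (hB2 : 2 ≤ B2.card) (hC1 : 2 ≤ C1.card) (hC2 : 2 ≤ C2.card)
    (hne : B1 ≠ B2) : Good A A' B1 B2 C1 C2 := by
  by_contra hG
  have key : ∀ b1 ∈ B1, ∀ b2 ∈ B2, ∀ c1 ∈ C1, ∀ c2 ∈ C2, b1 ≠ b2 → c1 ≠ c2 → b1 ≠ c1 → b2 ≠ c2 →
    ∃ x, x ≠ b1 ∧ x ≠ b2 ∧ x ≠ c1 ∧ x ≠ c2 ∧ A = {b1, b2, x} ∧ A' = {c1, c2, x} := by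
    intro b1 h1 b2 h2 c1 h3 c2 h4 n1 n2 n3 n4
    apply fin_step A A' hA hA'
    intro hc
    exact hG ⟨b1, h1, b2, h2, c1, h3, c2, h4, ⟨n1, n2, n3, n4⟩, hc⟩
  have key2 : ∀ b1 ∈ B1, ∀ b2 ∈ B2, ∀ c1 ∈ C1, ∀ c2 ∈ C2, b1 ≠ b2 → c1 ≠ c2 → b1 ≠ c1 → b2 ≠ c2 →
    b1 ∈ A ∧ b2 ∈ A ∧ c1 ∈ A' ∧ c2 ∈ A' ∧ ∃ x, x ≠ b1 ∧ x ≠ b2 ∧ x ≠ c1 ∧ x ≠ c2 ∧ x ∈ A ∧ x ∈ A' ∧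
      (∀ y ∈ A, y = b1 ∨ y = b2 ∨ y = x) ∧ (∀ y ∈ A', y = c1 ∨ y = c2 ∨ y = x) := by
    intro b1 h1 b2 h2 c1 h3 c2 h4 n1 n2 n3 n4
    obtain ⟨x, h⟩ := key b1 h1 b2 h2 c1 h3 c2 h4 n1 n2 n3 n4
    obtain ⟨x1, x2, x3, x4, rfl, rfl⟩ := h
    simp [x1, x2, x3, x4]
  clear key
  obtain ⟨p, hp, q, hq, r, hr, s, hs, e1, e2, e3, e4, e5⟩ := pair_sub B1 B2 hB1 hB2 hne
  by_cases hC : C1 = C2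
  · subst hC
    obtain ⟨t, ht, u, hu, htu⟩ := Finset.one_lt_card.1 (by omega : 1 < C1.card)
    have k1 := key2 p hp r hr t ht u hu
    have k2 := key2 p hp s hs t ht u hu
    have k3 := key2 q hq r hr t ht u hu
    have k4 := key2 p hp r hr u hu t ht
    have k5 := key2 p hp s hs u hu t ht
    have k6 := key2 q hq r hr u hu t ht
    clear key2 hG
    grind
  · obtain ⟨t, ht, u, hu, v, hv, w, hw, f1, f2, f3, f4, f5⟩ := pair_sub C1 C2 hC1 hC2 hC
    have k1 := key2 p hp r hr t ht v hv
    have k2 := key2 p hp r hr t ht w hw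
    have k3 := key2 p hp r hr u hu v hv
    have k4 := key2 p hp s hs t ht v hv
    have k5 := key2 p hp s hs t ht w hw
    have k6 := key2 p hp s hs u hu v hv
    have k7 := key2 q hq r hr t ht v hv
    have k8 := key2 q hq r hr t ht w hw
    have k9 := key2 q hq r hr u hu v hv
    clear key2 hG
    grind

/-- `K_{2,3}` with parts `{y, y'} = {inl 0, inl 1}` (degree-3 vertices) and
`{z, w₁, w₂} = {inr 0, inr 1, inr 2}` (degree-2 vertices). -/
theorem stmt_9
    (L : Sym2 (Fin 2 ⊕ Fin 3) → Finset ℕ)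
    (hyz : 3 ≤ (L s(Sum.inl 0, Sum.inr 0)).card)
    (hy'z : 3 ≤ (L s(Sum.inl 1, Sum.inr 0)).card)
    (hyw1 : 2 ≤ (L s(Sum.inl 0, Sum.inr 1)).card)
    (hyw2 : 2 ≤ (L s(Sum.inl 0, Sum.inr 2)).card)
    (hy'w1 : 2 ≤ (L s(Sum.inl 1, Sum.inr 1)).card)
    (hy'w2 : 2 ≤ (L s(Sum.inl 1, Sum.inr 2)).card)
    (hne : L s(Sum.inl 0, Sum.inr 1) ≠ L s(Sum.inl 0, Sum.inr 2)) :
    ∃ c : Sym2 (Fin 2 ⊕ Fin 3) → ℕ,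
      IsProperEdgeColoring (completeBipartiteGraph (Fin 2) (Fin 3)) L c := by
  obtain ⟨b1, hb1, b2, hb2, c1, hc1, c2, hc2, ⟨n1, n2, n3, n4⟩, a, ha, a', ha', m1, m2, m3, m4, m5⟩ :=
    good _ _ _ _ _ _ hyz hy'z hyw1 hyw2 hy'w1 hy'w2 hne
  let g : Fin 2 → Fin 3 → ℕ := ![![a, b1, b2], ![a', c1, c2]]
  let F : (Fin 2 ⊕ Fin 3) → (Fin 2 ⊕ Fin 3) → ℕ := fun x y =>
    match x, y with
    | Sum.inl i, Sum.inr j => g i j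
    | Sum.inr j, Sum.inl i => g i j
    | _, _ => 0
  have hF : ∀ x y, F x y = F y x := by
    rintro (i | i) (j | j) <;> rfl
  have hE : ∀ e ∈ (completeBipartiteGraph (Fin 2) (Fin 3)).edgeSet,
      ∃ i j, e = s(Sum.inl i, Sum.inr j) := by
    intro e
    induction e using Sym2.ind with
    | _ x y =>
      rcases x with i | i <;> rcases y with j | j <;> simp
  refine ⟨Sym2.lift ⟨F, hF⟩, ?_, ?_⟩
  · intro e he
    obtain ⟨i, j, rfl⟩ := hE e he
    change g i j ∈ _
    fin_cases i <;> fin_cases j <;> simpa [g]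
  · intro e he f hf hef hx
    obtain ⟨i, j, rfl⟩ := hE e he
    obtain ⟨k, l, rfl⟩ := hE f hf
    change g i j ≠ g k l
    have h1 : i = k ∨ j = l := by
      obtain ⟨x, h1, h2⟩ := hx
      simp only [Sym2.mem_iff] at h1 h2
      rcases h1 with rfl | rfl <;> simp_all
    have h2 : ¬ (i = k ∧ j = l) := by
      rintro ⟨rfl, rfl⟩; exact hef rfl
    clear hx hef he hf
    fin_cases i <;> fin_cases j <;> fin_cases k <;> fin_cases l <;> simp [g] at h1 h2 ⊢ <;> grind
end

section
/- Let k ≥ 3 be a natural number and let G be a finite simple graph such that: (i) for every vertex v of G with d(v) = 2, both neighbors of v have degree exactly k; and (ii) G contains no cycle on 2p pairwise distinct vertices u_1, v_1, u_2, v_2, …, u_p, v_p with p ≥ 2 (where u_i v_i and v_i u_{i+1} are edges, indices modulo p) in which every v_i has degree exactly 2. Then the number of vertices of G of degree 2 is at most the number of vertices of G of degree k. -/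
theorem aux_forest {W : Type*} [Fintype W] (H : SimpleGraph W) [Fintype H.edgeSet]
    (h : H.IsAcyclic) : H.edgeFinset.card ≤ Fintype.card W := by
  classical
  rcases isEmpty_or_nonempty W with hW | hW
  · have : H = ⊥ := Subsingleton.elim _ _
    subst this
    simp
  · obtain ⟨T, hT, hT1, hT2⟩ :=
      (SimpleGraph.connected_top (V := W)).exists_isTree_le_of_le_of_isAcyclic (H := H) le_top h
    have h1 := hT2.card_edgeFinset
    have h2 : H.edgeFinset.card ≤ T.edgeFinset.card :=
      Finset.card_le_card (SimpleGraph.edgeFinset_mono (by assumption))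
    omega

theorem aux_cycle {W : Type*} (H : SimpleGraph W) (P : W → Prop)
    (hP : ∀ x y, H.Adj x y → (P x ↔ ¬ P y)) (h : ¬ H.IsAcyclic) :
    ∃ (p : ℕ) (_ : 2 ≤ p) (u v : ZMod p → W),
      Function.Injective u ∧ Function.Injective v ∧ (∀ i j, u i ≠ v j) ∧
      (∀ i : ZMod p, H.Adj (u i) (v i) ∧ H.Adj (v i) (u (i + 1))) ∧
      (∀ i, P (v i)) := by
  classical
  have key : ∃ (a : W) (c : H.Walk a a), c.IsCycle ∧ ¬ P a := by
    simp only [SimpleGraph.IsAcyclic, not_forall, not_not] at h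
    obtain ⟨a, c, hc⟩ := h
    by_cases ha : P a
    · have hs : c.snd ∈ c.support := c.getVert_mem_support 1
      refine ⟨c.snd, c.rotate _ hs, hc.rotate hs, ?_⟩
      exact (hP _ _ (c.adj_snd hc.not_nil)).1 ha
    · exact ⟨a, c, hc, ha⟩
  obtain ⟨a, c, hc, ha⟩ := key
  have halt : ∀ i, i ≤ c.length → (P (c.getVert i) ↔ i % 2 = 1) := by
    intro i
    induction i with
    | zero => simp [ha]
    | succ i ih =>
      intro hi
      have h1 := hP _ _ (c.adj_getVert_succ (i := i) (by omega))
      have h2 := ih (by omega)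
      by_cases hq : P (c.getVert (i+1))
      · have : ¬ (i % 2 = 1) := by tauto
        simp only [hq, true_iff]; omega
      · have : (i % 2 = 1) := by tauto
        simp only [hq, false_iff]; omega
  have hlen := hc.three_le_length
  have heven : c.length % 2 = 0 := by
    have := halt c.length le_rfl
    rw [c.getVert_length] at this
    have : ¬ (c.length % 2 = 1) := by tauto
    omega
  obtain ⟨p, hp⟩ : ∃ p, c.length = 2 * p := ⟨c.length / 2, by omega⟩
  have hp2 : 2 ≤ p := by omega
  have : NeZero p := ⟨by omega⟩
  have : Fact (1 < p) := ⟨by omega⟩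
  have hinj : ∀ m n, m < 2 * p → n < 2 * p → c.getVert m = c.getVert n → m = n := by
    intro m n hm hn he
    exact hc.getVert_injOn' (by simp only [Set.mem_ofPred_eq]; omega)
      (by simp only [Set.mem_ofPred_eq]; omega) he
  refine ⟨p, hp2, fun i => c.getVert (2 * i.val), fun i => c.getVert (2 * i.val + 1),
    ?_, ?_, ?_, ?_, ?_⟩
  · intro i j hij
    have hi := i.val_lt
    have hj := j.val_lt
    have := hinj _ _ (by omega) (by omega) hij
    exact ZMod.val_injective p (by omega)
  · intro i j hij
    have hi := i.val_lt
    have hj := j.val_lt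
    have := hinj _ _ (by omega) (by omega) hij
    exact ZMod.val_injective p (by omega)
  · intro i j hij
    have hi := i.val_lt
    have hj := j.val_lt
    have := hinj _ _ (by omega) (by omega) hij
    omega
  · intro i
    have hi := i.val_lt
    refine ⟨c.adj_getVert_succ (by omega), ?_⟩
    have h1 := c.adj_getVert_succ (i := 2 * i.val + 1) (by omega)
    have h2 : c.getVert (2 * (i + 1).val) = c.getVert (2 * i.val + 1 + 1) := by
      rw [ZMod.val_add, ZMod.val_one]
      rcases Nat.lt_or_ge (i.val + 1) p with hlt | hge
      · rw [Nat.mod_eq_of_lt hlt]; rfl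
      · have : i.val + 1 = p := by omega
        rw [this, Nat.mod_self, show 2 * i.val + 1 + 1 = c.length by omega, c.getVert_length]
        simp
    simp only [h2]
    exact h1
  · intro i
    have hi := i.val_lt
    exact (halt _ (by omega)).2 (by omega)

theorem stmt_10 {V : Type*} [Fintype V] [DecidableEq V]
    (G : SimpleGraph V) [DecidableRel G.Adj]
    (k : ℕ) (hk : 3 ≤ k)
    (hnbr : ∀ v, G.degree v = 2 → ∀ w, G.Adj v w → G.degree w = k)
    (hnocycle : ¬ ∃ (p : ℕ) (_ : 2 ≤ p) (u v : ZMod p → V),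
      Function.Injective u ∧ Function.Injective v ∧ (∀ i j, u i ≠ v j) ∧
      (∀ i : ZMod p, G.Adj (u i) (v i) ∧ G.Adj (v i) (u (i + 1))) ∧
      (∀ i, G.degree (v i) = 2)) :
    (Finset.univ.filter (fun v => G.degree v = 2)).card ≤
      (Finset.univ.filter (fun v => G.degree v = k)).card := by
  classical
  let W := {v : V // G.degree v = 2 ∨ G.degree v = k}
  let H : SimpleGraph W :=
    { Adj := fun x y => G.Adj x.1 y.1 ∧ (G.degree x.1 = 2 ∨ G.degree y.1 = 2)
      symm := ⟨fun x y h => ⟨h.1.symm, h.2.symm⟩⟩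
      loopless := ⟨fun x h => G.loopless.irrefl _ h.1⟩ }
  have hP : ∀ x y : W, H.Adj x y → (G.degree x.1 = 2 ↔ ¬ G.degree y.1 = 2) := by
    rintro x y ⟨h1, h2⟩
    constructor
    · intro h
      have := hnbr _ h _ h1
      omega
    · tauto
  have hac : H.IsAcyclic := by
    by_contra hcon
    obtain ⟨p, hp, u, v, hu, hv, huv, hadj, hd⟩ :=
      aux_cycle H (fun x => G.degree x.1 = 2) hP hcon
    exact hnocycle ⟨p, hp, fun i => (u i).1, fun i => (v i).1,
      Subtype.val_injective.comp hu, Subtype.val_injective.comp hv,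
      fun i j h => huv i j (Subtype.ext h),
      fun i => ⟨(hadj i).1.1, (hadj i).2.1⟩, hd⟩
  have hcard := aux_forest H hac
  have hbip : H.IsBipartiteWith
      (↑(Finset.univ.filter (fun x : W => G.degree x.1 = 2)) : Set W)
      (↑(Finset.univ.filter (fun x : W => ¬ G.degree x.1 = 2)) : Set W) := by
    refine ⟨?_, ?_⟩
    · rw [Finset.disjoint_coe]
      exact Finset.disjoint_filter_filter_not _ _ _
    · intro x y h
      have := hP x y h
      simp only [Finset.coe_filter, Finset.mem_univ, true_and, Set.mem_ofPred_eq]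
      tauto
  have hsum := SimpleGraph.isBipartiteWith_sum_degrees_eq_card_edges hbip
  have hdeg : ∀ x ∈ Finset.univ.filter (fun x : W => G.degree x.1 = 2), H.degree x = 2 := by
    intro x hx
    have hx2 : G.degree x.1 = 2 := by simpa using hx
    refine Eq.trans ?_ hx2
    rw [← SimpleGraph.card_neighborFinset_eq_degree,
      ← SimpleGraph.card_neighborFinset_eq_degree]
    refine Finset.card_bij (fun y _ => y.1) ?_ ?_ ?_
    · intro y hy
      rw [SimpleGraph.mem_neighborFinset] at hy ⊢
      exact hy.1
    · intro y _ z _ h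
      exact Subtype.ext h
    · intro y hy
      rw [SimpleGraph.mem_neighborFinset] at hy
      refine ⟨⟨y, Or.inr (hnbr _ hx2 _ hy)⟩, ?_, rfl⟩
      rw [SimpleGraph.mem_neighborFinset]
      exact ⟨hy, Or.inl hx2⟩
  rw [Finset.sum_congr rfl hdeg, Finset.sum_const, smul_eq_mul] at hsum
  have hA : (Finset.univ.filter (fun x : W => G.degree x.1 = 2)).card =
      (Finset.univ.filter (fun v => G.degree v = 2)).card := by
    refine Finset.card_bij (fun y _ => y.1) ?_ ?_ ?_
    · intro y hy
      simpa using hy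
    · intro y _ z _ h
      exact Subtype.ext h
    · intro y hy
      have hy2 : G.degree y = 2 := by simpa using hy
      exact ⟨⟨y, Or.inl hy2⟩, by simpa using hy2, rfl⟩
  have hW : Fintype.card W ≤ (Finset.univ.filter (fun v => G.degree v = 2)).card +
      (Finset.univ.filter (fun v => G.degree v = k)).card := by
    rw [Fintype.card_subtype, Finset.filter_or]
    exact Finset.card_union_le _ _
  omega
end
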